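/- arXiv:2301.05733 — 7 statements merged into one kernel-verified Lean document; each statement's English description precedes it below -/
import Mathlib

section
/- Let F(u)=e^u/(1+e^u) be the logistic CDF, let θ≠0 be a real number, and let S⊂ℝ contain at least three distinct points. Then the functions on S given by α↦1, α↦F(α), and α↦F(θ+α) are linearly independent: if real numbers A, B, C satisfy A·F(θ+α)+B·F(α)+C=0 for every α∈S, then A=B=C=0. -/
/-- **Linear independence in the logit model**: if `F` is the logistic CDF, `θ ≠ 0`, and
`S ⊆ ℝ` contains at least three distinct points, then the functions `α ↦ 1`, `α ↦ F(α)`,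
`α ↦ F(θ+α)` are linearly independent on `S`. -/
theorem statement_2 (θ : ℝ) (hθ : θ ≠ 0) (S : Set ℝ)
    (hS : ∃ a ∈ S, ∃ b ∈ S, ∃ c ∈ S, a ≠ b ∧ a ≠ c ∧ b ≠ c)
    (A B C : ℝ)
    (h : ∀ α ∈ S, A * (Real.exp (θ + α) / (1 + Real.exp (θ + α))) +
      B * (Real.exp α / (1 + Real.exp α)) + C = 0) :
    A = 0 ∧ B = 0 ∧ C = 0 := by
  obtain ⟨a, ha, b, hb, c, hc, hab, hac, hbc⟩ := hS
  have ht : Real.exp θ ≠ 1 := by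
    intro h1
    exact hθ (Real.exp_eq_one_iff θ |>.mp h1)
  have ht0 : Real.exp θ ≠ 0 := (Real.exp_pos θ).ne'
  have key : ∀ α ∈ S, (Real.exp θ * (A + B + C)) * Real.exp α ^ 2 +
      (A * Real.exp θ + B + C * (Real.exp θ + 1)) * Real.exp α + C = 0 := by
    intro α hα
    have h1 := h α hα
    rw [Real.exp_add] at h1
    have hx := Real.exp_pos α
    have ht' := Real.exp_pos θ
    have h2 : 1 + Real.exp α ≠ 0 := by positivity
    have h3 : 1 + Real.exp θ * Real.exp α ≠ 0 := by positivity
    field_simp at h1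
    linear_combination h1
  have xa := key a ha
  have xb := key b hb
  have xc := key c hc
  have hab' : Real.exp a - Real.exp b ≠ 0 := sub_ne_zero.mpr (fun e => hab (Real.exp_injective e))
  have hac' : Real.exp a - Real.exp c ≠ 0 := sub_ne_zero.mpr (fun e => hac (Real.exp_injective e))
  have hbc' : Real.exp b - Real.exp c ≠ 0 := sub_ne_zero.mpr (fun e => hbc (Real.exp_injective e))
  generalize Real.exp a = x at *
  generalize Real.exp b = y at *
  generalize Real.exp c = z at *
  generalize Real.exp θ = t at *
  generalize hp : t * (A + B + C) = p at *
  generalize hq : A * t + B + C * (t + 1) = q at *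
  have e1 : p * (x + y) + q = 0 := by
    apply mul_left_cancel₀ hab'
    linear_combination xa - xb
  have e2 : p * (x + z) + q = 0 := by
    apply mul_left_cancel₀ hac'
    linear_combination xa - xc
  have p0 : p = 0 := by
    apply mul_left_cancel₀ hbc'
    linear_combination e1 - e2
  have q0 : q = 0 := by
    linear_combination e1 - (x + y) * p0
  have C0 : C = 0 := by
    linear_combination xa - x ^ 2 * p0 - x * q0
  have s0 : A + B + C = 0 := by
    apply mul_left_cancel₀ ht0
    linear_combination hp + p0
  have A0 : A = 0 := by
    apply mul_left_cancel₀ (sub_ne_zero.mpr ht)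
    linear_combination hq + q0 - s0 - t * C0
  exact ⟨A0, by linear_combination s0 - A0 - C0, C0⟩
end

section
/- Let F(u)=1−e^{−u}, θ∈ℝ, and S⊂[0,∞) a finite set with θ·x+α≥0 for all x∈{0,1}, α∈S. Define the moment function φ_{x_1}(y_1,y_2,x_2;θ)=(1−y_2)e^{θx_2}−(1−y_1)e^{θx_1}. Then for each x_1∈{0,1}: (i) for all α∈S and y_1∈{0,1}, the quantity Σ_{y_2=0}^1 φ_{x_1}(y_1,y_2,x_2;θ)·F(θx_2+α)^{y_2}(1−F(θx_2+α))^{1−y_2} does not depend on x_2∈{0,1}; and (ii) for all α∈S and x_2∈{0,1}, Σ_{y_1=0}^1 Σ_{y_2=0}^1 φ_{x_1}(y_1,y_2,x_2;θ)·F(θx_2+α)^{y_2}(1−F(θx_2+α))^{1−y_2}·F(θx_1+α)^{y_1}(1−F(θx_1+α))^{1−y_1} = 0. -/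
open Finset

noncomputable section

/-- Real indicator of a boolean value: `bx true = 1`, `bx false = 0`. -/
def bx (b : Bool) : ℝ := if b then 1 else 0

/-- `bpow y p = p^y (1-p)^(1-y)` for a binary outcome `y`. -/
def bpow (b : Bool) (p : ℝ) : ℝ := if b then p else 1 - p

/-- The exponential binary choice CDF `F(u) = 1 - e^{-u}`. -/
def Fexp (u : ℝ) : ℝ := 1 - Real.exp (-u)

/-- The moment function `φ_{x₁}(y₁,y₂,x₂;θ) = (1-y₂)e^{θx₂} - (1-y₁)e^{θx₁}`. -/
def phiExp (θ : ℝ) (x1 y1 y2 x2 : Bool) : ℝ :=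
  (1 - bx y2) * Real.exp (θ * bx x2) - (1 - bx y1) * Real.exp (θ * bx x1)

theorem phiExp_inner_sum (θ α : ℝ) (x1 y1 x2 : Bool) :
    (∑ y2 : Bool, phiExp θ x1 y1 y2 x2 * bpow y2 (Fexp (θ * bx x2 + α))) =
      Real.exp (-α) - (1 - bx y1) * Real.exp (θ * bx x1) := by
  have h : Real.exp (θ * bx x2) * Real.exp (-(θ * bx x2 + α)) = Real.exp (-α) := by
    rw [← Real.exp_add]; congr 1; ring
  have ht : bx true = 1 := rfl
  have hf : bx false = 0 := rfl
  simp only [Fintype.sum_bool, phiExp, bpow, Fexp, ht, hf, if_true, Bool.false_eq_true, if_false]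
  linear_combination h

/-- **The exponential-model moment function is feedback robust (i) and
heterogeneity robust (ii)** in the sense of Lemma 1 of the paper. -/
theorem statement_6 (θ : ℝ) (S : Finset ℝ)
    (hS : ∀ α ∈ S, ∀ x : Bool, 0 ≤ θ * bx x + α) (x1 : Bool) :
    (∀ α ∈ S, ∀ y1 : Bool, ∀ x2 x2' : Bool,
      (∑ y2 : Bool, phiExp θ x1 y1 y2 x2 * bpow y2 (Fexp (θ * bx x2 + α))) =
      (∑ y2 : Bool, phiExp θ x1 y1 y2 x2' * bpow y2 (Fexp (θ * bx x2' + α)))) ∧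
    (∀ α ∈ S, ∀ x2 : Bool,
      (∑ y1 : Bool, ∑ y2 : Bool, phiExp θ x1 y1 y2 x2 *
        bpow y2 (Fexp (θ * bx x2 + α)) * bpow y1 (Fexp (θ * bx x1 + α))) = 0) := by
  refine ⟨fun α _ y1 x2 x2' => ?_, fun α _ x2 => ?_⟩
  · rw [phiExp_inner_sum, phiExp_inner_sum]
  · have h : Real.exp (θ * bx x1) * Real.exp (-(θ * bx x1 + α)) = Real.exp (-α) := by
      rw [← Real.exp_add]; congr 1; ring
    have ht : bx true = 1 := rfl
    have hf : bx false = 0 := rfl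
    simp only [← Finset.sum_mul, phiExp_inner_sum]
    simp only [Fintype.sum_bool, bpow, Fexp, ht, hf, if_true, Bool.false_eq_true, if_false]
    linear_combination -h
end
end

section
/- Consider the exponential binary choice model with T=2: F(u)=1−e^{−u}, finite support S⊂ℝ with α>0 and θ+α>0 for all α∈S (so F(θx+α)∈(0,1) for x∈{0,1}, α∈S), heterogeneity weights π_{x_1}(α)>0 summing to one over S for each x_1∈{0,1}, and feedback probabilities G^2_{y_1,x_1}(α)∈(0,1). For θ̃∈ℝ define the population moment φ̄_{x_1}(θ̃) = Σ_{α∈S} Σ_{y_1∈{0,1}} Σ_{x_2∈{0,1}} Σ_{y_2∈{0,1}} [(1−y_2)e^{θ̃x_2}−(1−y_1)e^{θ̃x_1}] · F(θx_2+α)^{y_2}(1−F(θx_2+α))^{1−y_2} · G^2_{y_1,x_1}(α)^{x_2}(1−G^2_{y_1,x_1}(α))^{1−x_2} · F(θx_1+α)^{y_1}(1−F(θx_1+α))^{1−y_1} · π_{x_1}(α). Then φ̄_0 is strictly increasing on ℝ, φ̄_1 is strictly decreasing on ℝ, and for each x_1∈{0,1}, θ is the unique solution of φ̄_{x_1}(θ̃)=0.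 -/
open Finset

noncomputable section

/-- The population moment `φ̄_{x₁}(θ̃) = E[(1-Y₂)e^{θ̃X₂} - (1-Y₁)e^{θ̃X₁} | X₁ = x₁]`
implied by the two-period exponential model with true parameter `θ`, heterogeneity
weights `π` and feedback `G`. -/
def phibar (S : Finset ℝ) (θ : ℝ) (π : Bool → ↥S → ℝ)
    (G : Bool → Bool → ↥S → ℝ) (x1 : Bool) (θt : ℝ) : ℝ :=
  ∑ α : ↥S, ∑ y1 : Bool, ∑ x2 : Bool, ∑ y2 : Bool,
    ((1 - bx y2) * Real.exp (θt * bx x2) - (1 - bx y1) * Real.exp (θt * bx x1)) *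
    bpow y2 (Fexp (θ * bx x2 + ↑α)) * bpow x2 (G y1 x1 α) *
    bpow y1 (Fexp (θ * bx x1 + ↑α)) * π x1 α

/-- Probability that `X₂ = 1` given `X₁ = x₁` and `α`. -/
def qprob (S : Finset ℝ) (θ : ℝ) (G : Bool → Bool → ↥S → ℝ) (x1 : Bool) (α : ↥S) : ℝ :=
  Fexp (θ * bx x1 + ↑α) * G true x1 α + (1 - Fexp (θ * bx x1 + ↑α)) * G false x1 α

theorem qprob_mem (S : Finset ℝ) (θ : ℝ)
    (hSpos : ∀ α ∈ S, 0 < α ∧ 0 < θ + α) (G : Bool → Bool → ↥S → ℝ)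
    (hG : ∀ y1 x1 α, G y1 x1 α ∈ Set.Ioo (0:ℝ) 1) (x1 : Bool) (α : ↥S) :
    0 < qprob S θ G x1 α ∧ qprob S θ G x1 α < 1 := by
  obtain ⟨h1, h2⟩ := hSpos α α.2
  have hu : 0 < θ * bx x1 + ↑α := by cases x1 <;> simp [bx] <;> assumption
  have hF0 : 0 < Fexp (θ * bx x1 + ↑α) := by
    have : Real.exp (-(θ * bx x1 + ↑α)) < 1 := Real.exp_lt_one_iff.2 (by linarith)
    unfold Fexp; linarith
  have hF1 : 0 < 1 - Fexp (θ * bx x1 + ↑α) := by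
    have := Real.exp_pos (-(θ * bx x1 + ↑α))
    unfold Fexp; linarith
  obtain ⟨a1, a2⟩ := hG true x1 α
  obtain ⟨b1, b2⟩ := hG false x1 α
  unfold qprob
  constructor
  · positivity
  · nlinarith [mul_pos hF0 (sub_pos.2 a2), mul_pos hF1 (sub_pos.2 b2)]

theorem phibar_false (S : Finset ℝ) (θ : ℝ) (π : Bool → ↥S → ℝ)
    (G : Bool → Bool → ↥S → ℝ) (θt : ℝ) :
    phibar S θ π G false θt =
      (∑ α : ↥S, Real.exp (-↑α) * qprob S θ G false α * π false α) *
        (Real.exp (θt - θ) - 1) := by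
  unfold phibar qprob
  rw [Finset.sum_mul]
  refine Finset.sum_congr rfl fun α _ => ?_
  have e1 : Real.exp (-(θ + ↑α)) = Real.exp (-θ) * Real.exp (-↑α) := by
    rw [← Real.exp_add]; ring_nf
  have e2 : Real.exp (θt - θ) = Real.exp θt * Real.exp (-θ) := by
    rw [← Real.exp_add]; ring_nf
  simp only [Fintype.sum_bool, bx, bpow, Fexp, if_true, Bool.false_eq_true, if_false, mul_one,
    mul_zero, zero_add, Real.exp_zero, e1, e2]
  ring

theorem phibar_true (S : Finset ℝ) (θ : ℝ) (π : Bool → ↥S → ℝ)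
    (G : Bool → Bool → ↥S → ℝ) (θt : ℝ) :
    phibar S θ π G true θt =
      (∑ α : ↥S, Real.exp (-↑α) * (1 - qprob S θ G true α) * π true α) *
        (1 - Real.exp (θt - θ)) := by
  unfold phibar qprob
  rw [Finset.sum_mul]
  refine Finset.sum_congr rfl fun α _ => ?_
  have e1 : Real.exp (-(θ + ↑α)) = Real.exp (-θ) * Real.exp (-↑α) := by
    rw [← Real.exp_add]; ring_nf
  have e2 : Real.exp (θt - θ) = Real.exp θt * Real.exp (-θ) := by
    rw [← Real.exp_add]; ring_nf
  simp only [Fintype.sum_bool, bx, bpow, Fexp, if_true, Bool.false_eq_true, if_false, mul_one,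
    mul_zero, zero_add, Real.exp_zero, e1, e2]
  ring

/-- **Point identification in the exponential model (Appendix D)**: `φ̄₀` is strictly
increasing, `φ̄₁` is strictly decreasing, and for each `x₁` the true `θ` is the unique
zero of `φ̄_{x₁}`. -/
theorem statement_7 (S : Finset ℝ) (θ : ℝ)
    (hSpos : ∀ α ∈ S, 0 < α ∧ 0 < θ + α)
    (π : Bool → ↥S → ℝ) (G : Bool → Bool → ↥S → ℝ)
    (hπpos : ∀ x1 α, 0 < π x1 α)
    (hπsum : ∀ x1, ∑ α : ↥S, π x1 α = 1)
    (hG : ∀ y1 x1 α, G y1 x1 α ∈ Set.Ioo (0:ℝ) 1) :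
    StrictMono (phibar S θ π G false) ∧ StrictAnti (phibar S θ π G true) ∧
    ∀ (x1 : Bool) (θt : ℝ), phibar S θ π G x1 θt = 0 ↔ θt = θ := by
  have hne : (Finset.univ : Finset ↥S).Nonempty := by
    by_contra h
    rw [Finset.not_nonempty_iff_eq_empty] at h
    have := hπsum true
    rw [h] at this
    simp at this
  have hC0 : 0 < ∑ α : ↥S, Real.exp (-↑α) * qprob S θ G false α * π false α :=
    Finset.sum_pos (fun α _ => mul_pos (mul_pos (Real.exp_pos _)
      (qprob_mem S θ hSpos G hG false α).1) (hπpos _ _)) hne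
  have hC1 : 0 < ∑ α : ↥S, Real.exp (-↑α) * (1 - qprob S θ G true α) * π true α :=
    Finset.sum_pos (fun α _ => mul_pos (mul_pos (Real.exp_pos _)
      (sub_pos.2 (qprob_mem S θ hSpos G hG true α).2)) (hπpos _ _)) hne
  refine ⟨fun a b hab => ?_, fun a b hab => ?_, fun x1 θt => ?_⟩
  · rw [phibar_false, phibar_false]
    have : Real.exp (a - θ) < Real.exp (b - θ) := Real.exp_lt_exp.2 (by linarith)
    exact mul_lt_mul_of_pos_left (by linarith) hC0
  · rw [phibar_true, phibar_true]
    have : Real.exp (a - θ) < Real.exp (b - θ) := Real.exp_lt_exp.2 (by linarith)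
    exact mul_lt_mul_of_pos_left (by linarith) hC1
  · cases x1
    · rw [phibar_false, mul_eq_zero, or_iff_right hC0.ne', sub_eq_zero, Real.exp_eq_one_iff,
        sub_eq_zero]
    · rw [phibar_true, mul_eq_zero, or_iff_right hC1.ne', sub_eq_zero, eq_comm,
        Real.exp_eq_one_iff, sub_eq_zero]
end
end

section
/- Consider the exponential binary choice model with T=2: F(u)=1−e^{−u}, finite support S⊂ℝ with θx+α≥0 for x∈{0,1} and α∈S, heterogeneity weights π_{x_1}(α)≥0 summing to one, and feedback probabilities G^2_{y_1,x_1}(α)∈[0,1]. Then for each x_1∈{0,1}, the model-implied conditional moment vanishes at the true θ: Σ_{α∈S} Σ_{y_1∈{0,1}} Σ_{x_2∈{0,1}} Σ_{y_2∈{0,1}} [(1−y_2)e^{θx_2}−(1−y_1)e^{θx_1}] · F(θx_2+α)^{y_2}(1−F(θx_2+α))^{1−y_2} · G^2_{y_1,x_1}(α)^{x_2}(1−G^2_{y_1,x_1}(α))^{1−x_2} · F(θx_1+α)^{y_1}(1−F(θx_1+α))^{1−y_1} · π_{x_1}(α) = 0. -/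
open Finset

noncomputable section

/-- **Moment restriction in the exponential model (equation (6) of the paper)**: the
model-implied conditional moment vanishes at the true parameter `θ`. -/
theorem statement_8 (S : Finset ℝ) (θ : ℝ)
    (hSpos : ∀ α ∈ S, ∀ x : Bool, 0 ≤ θ * bx x + α)
    (π : Bool → ↥S → ℝ) (G : Bool → Bool → ↥S → ℝ)
    (hπ : ∀ x1 α, 0 ≤ π x1 α)
    (hπsum : ∀ x1, ∑ α : ↥S, π x1 α = 1)
    (hG : ∀ y1 x1 α, G y1 x1 α ∈ Set.Icc (0:ℝ) 1) :
    ∀ x1 : Bool, phibar S θ π G x1 θ = 0 := by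
  intro x1
  unfold phibar
  refine Finset.sum_eq_zero fun α _ => ?_
  have hE : Real.exp θ ≠ 0 := Real.exp_ne_zero θ
  have h : Real.exp (-(θ + (α : ℝ))) = (Real.exp θ)⁻¹ * Real.exp (-(α : ℝ)) := by
    rw [neg_add, Real.exp_add, Real.exp_neg θ]
  cases x1 <;>
  · simp only [Fintype.sum_bool, bx, bpow, Fexp, if_true, if_false, Bool.false_eq_true,
      mul_one, mul_zero, zero_add, Real.exp_zero, h]
    field_simp
    ring
end
end

section
/- Consider the binary choice panel model with T=2, a strictly increasing CDF F:ℝ→ℝ, finite support S⊂ℝ, heterogeneity weights π_{x_1}(α)>0 summing to one over S for each x_1∈{0,1}, feedback probabilities G^2_{y_1,x_1}(α)∈(0,1), and F(θx+α)∈(0,1) for all x∈{0,1}, α∈S. Define for x_1∈{0,1} the model-implied quantity m_{x_1} = E[Y_2−Y_1|X_1=x_1] = Σ_{α∈S} Σ_{y_1∈{0,1}} (F(θ(1−x_1)·1_{x_2=1 term})…); explicitly, m_0 = Σ_{α∈S} Σ_{y_1∈{0,1}} (F(θ+α)−F(α)) · G^2_{y_1,0}(α) · F(α)^{y_1}(1−F(α))^{1−y_1}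 · π_0(α) and m_1 = Σ_{α∈S} Σ_{y_1∈{0,1}} (F(θ+α)−F(α)) · (1−G^2_{y_1,1}(α)) · F(θ+α)^{y_1}(1−F(θ+α))^{1−y_1} · π_1(α) satisfies E[Y_1−Y_2|X_1=1]=m_1. Then sign(θ) = sign(m_0) = sign(m_1): θ>0 iff m_0>0, θ=0 iff m_0=0, θ<0 iff m_0<0, and the same with m_1. -/
open Finset

noncomputable section

/-- The model-implied quantity `m₀ = E[Y₂ - Y₁ | X₁ = 0]` in the two-period binary
choice panel model with a predetermined binary covariate. -/
def m0 (S : Finset ℝ) (F : ℝ → ℝ) (θ : ℝ) (π : Bool → ↥S → ℝ)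
    (G : Bool → Bool → ↥S → ℝ) : ℝ :=
  ∑ α : ↥S, ∑ y1 : Bool,
    (F (θ + ↑α) - F ↑α) * G y1 false α * bpow y1 (F ↑α) * π false α

/-- The model-implied quantity `m₁ = E[Y₁ - Y₂ | X₁ = 1]` in the two-period binary
choice panel model with a predetermined binary covariate. -/
def m1 (S : Finset ℝ) (F : ℝ → ℝ) (θ : ℝ) (π : Bool → ↥S → ℝ)
    (G : Bool → Bool → ↥S → ℝ) : ℝ :=
  ∑ α : ↥S, ∑ y1 : Bool,
    (F (θ + ↑α) - F ↑α) * (1 - G y1 true α) * bpow y1 (F (θ + ↑α)) * π true α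

theorem sign_aux (S : Finset ℝ) (F : ℝ → ℝ) (hF : StrictMono F) (θ : ℝ)
    (hne : (Finset.univ : Finset ↥S).Nonempty) (w : ↥S → ℝ) (hw : ∀ α, 0 < w α) (m : ℝ)
    (hm : m = ∑ α : ↥S, (F (θ + ↑α) - F ↑α) * w α) :
    (0 < θ ↔ 0 < m) ∧ (θ = 0 ↔ m = 0) ∧ (θ < 0 ↔ m < 0) := by
  have h1 : 0 < θ → 0 < m := by
    intro h
    rw [hm]
    refine Finset.sum_pos (fun α _ => mul_pos (sub_pos.2 (hF ?_)) (hw α)) hne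
    linarith
  have h2 : θ = 0 → m = 0 := by
    intro h
    rw [hm, h]
    simp
  have h3 : θ < 0 → m < 0 := by
    intro h
    rw [hm]
    refine Finset.sum_neg (fun α _ => mul_neg_of_neg_of_pos (sub_neg.2 (hF ?_)) (hw α)) hne
    linarith
  rcases lt_trichotomy θ 0 with h | h | h
  · have := h3 h
    refine ⟨⟨h1, fun _ => ?_⟩, ⟨h2, fun _ => ?_⟩, ⟨h3, fun _ => h⟩⟩ <;> linarith
  · have := h2 h
    refine ⟨⟨h1, fun _ => ?_⟩, ⟨h2, fun _ => h⟩, ⟨h3, fun _ => ?_⟩⟩ <;> linarith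
  · have := h1 h
    refine ⟨⟨h1, fun _ => h⟩, ⟨h2, fun _ => ?_⟩, ⟨h3, fun _ => ?_⟩⟩ <;> linarith

theorem bpow_pos_aux (b : Bool) (p : ℝ) (hp : p ∈ Set.Ioo (0:ℝ) 1) : 0 < bpow b p := by
  obtain ⟨h0, h1⟩ := hp
  cases b <;> simp [bpow] <;> linarith

/-- **Remark 1 (sign identification of θ)**: under interiority and strict monotonicity
of `F`, `sign(θ) = sign(m₀) = sign(m₁)`. -/
theorem statement_9 (S : Finset ℝ) (F : ℝ → ℝ) (hF : StrictMono F)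
    (hFbot : Filter.Tendsto F Filter.atBot (nhds 0))
    (hFtop : Filter.Tendsto F Filter.atTop (nhds 1))
    (θ : ℝ) (π : Bool → ↥S → ℝ) (G : Bool → Bool → ↥S → ℝ)
    (hπpos : ∀ x1 α, 0 < π x1 α)
    (hπsum : ∀ x1, ∑ α : ↥S, π x1 α = 1)
    (hG : ∀ y1 x1 α, G y1 x1 α ∈ Set.Ioo (0:ℝ) 1)
    (hFint : ∀ (x : Bool) (α : ↥S), F (θ * bx x + ↑α) ∈ Set.Ioo (0:ℝ) 1) :
    ((0 < θ ↔ 0 < m0 S F θ π G) ∧ (θ = 0 ↔ m0 S F θ π G = 0) ∧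
      (θ < 0 ↔ m0 S F θ π G < 0)) ∧
    ((0 < θ ↔ 0 < m1 S F θ π G) ∧ (θ = 0 ↔ m1 S F θ π G = 0) ∧
      (θ < 0 ↔ m1 S F θ π G < 0)) := by
  have hne : (Finset.univ : Finset ↥S).Nonempty := by
    by_contra h
    have h' := hπsum true
    rw [Finset.not_nonempty_iff_eq_empty.1 h] at h'
    simp at h'
  have hF0 : ∀ α : ↥S, F ↑α ∈ Set.Ioo (0:ℝ) 1 := fun α => by
    have := hFint false α
    simpa [bx] using this
  have hF1 : ∀ α : ↥S, F (θ + ↑α) ∈ Set.Ioo (0:ℝ) 1 := fun α => by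
    have := hFint true α
    simpa [bx] using this
  constructor
  · refine sign_aux S F hF θ hne
      (fun α => ∑ y1 : Bool, G y1 false α * bpow y1 (F ↑α) * π false α) ?_ _ ?_
    · intro α
      exact Finset.sum_pos (fun y _ => mul_pos (mul_pos (hG y false α).1
        (bpow_pos_aux y _ (hF0 α))) (hπpos _ _)) Finset.univ_nonempty
    · simp only [m0, Finset.mul_sum, mul_assoc]
  · refine sign_aux S F hF θ hne
      (fun α => ∑ y1 : Bool, (1 - G y1 true α) * bpow y1 (F (θ + ↑α)) * π true α) ?_ _ ?_
    · intro α
      exact Finset.sum_pos (fun y _ => mul_pos (mul_pos (sub_pos.2 (hG y true α).2)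
        (bpow_pos_aux y _ (hF1 α))) (hπpos _ _)) Finset.univ_nonempty
    · simp only [m1, Finset.mul_sum, mul_assoc]
end
end

section
/- Let T≥2, S⊂ℝ finite, F:ℝ→[0,1], and let (θ,π,G) be true parameters of the binary choice panel model with a binary predetermined covariate, with conditional likelihood Q_{x_1}(y^T,x^{2:T};θ,π,G)=Σ_{α∈S}Π_{t=1}^T F(θx_t+α)^{y_t}(1−F(θx_t+α))^{1−y_t}·Π_{t=2}^T G^t_{y^{t−1},x^{t−1}}(α)^{x_t}(1−G^t_{y^{t−1},x^{t−1}}(α))^{1−x_t}·π_{x_1}(α). Then θ̃∈Θ^I (i.e., there exist heterogeneity weights π̃_{x_1}≥0 on S summing to one and feedback probabilities G̃^t_{y^{t−1},x^{t−1}}(α)∈[0,1] such that Q_{x_1}(·;θ̃,π̃,G̃)=Q_{x_1}(·;θ,π,G) for x_1∈{0,1}) if and only if there exist functions ψ_{x_1}:{0,1}^{T−1}×{0,1}^{T−1}×S→ℝ (arguments (x^{2:T},y^{T−1},α)), x_1∈{0,1}, satisfying: (IS1) for all (y^T,x^{2:T}): Q_{x_1}(y^T,x^{2:T};θ,π,G)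 = Σ_{α∈S} F(θ̃x_T+α)^{y_T}(1−F(θ̃x_T+α))^{1−y_T}·ψ_{x_1}(x^{2:T},y^{T−1},α); (IS2) ψ_{x_1}(x^{2:T},y^{T−1},α)≥0 everywhere and Σ_{x^{2:T}}Σ_{y^{T−1}}Σ_{α∈S} ψ_{x_1}(x^{2:T},y^{T−1},α)=1; and (IS3) for all s∈{2,…,T}, all α∈S and all (y^{s−1},x^{s−1}): Σ_{x^{s:T}}Σ_{y^{s:T−1}} ψ_{x_1}(x^{2:T},y^{T−1},α) = F(θ̃x_{s−1}+α)^{y_{s−1}}(1−F(θ̃x_{s−1}+α))^{1−y_{s−1}} · Σ_{x^{s:T}}Σ_{y^{s−1:T−1}} ψ_{x_1}(x^{2:T},y^{T−1},α). -/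
open Finset

noncomputable section

/-- Feedback process: for each period `t` (0-based; periods `t ≥ 1` are relevant),
the probability that `X_{t+1} = 1` given the histories and the heterogeneity `α`. -/
abbrev Feedback (T : ℕ) (S : Finset ℝ) : Type :=
  (t : Fin T) → (Fin (t : ℕ) → Bool) → (Fin (t : ℕ) → Bool) → ↥S → ℝ

/-- Restriction of a full path to the history before period `t`. -/
def restr {T : ℕ} (z : Fin T → Bool) (t : Fin T) : Fin (t : ℕ) → Bool :=
  fun i => z ⟨(i : ℕ), lt_trans i.isLt t.isLt⟩

/-- Parameter space of the T-period model. -/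
abbrev ParamT (T : ℕ) (S : Finset ℝ) : Type :=
  ℝ × (Bool → ↥S → ℝ) × Feedback T S

/-- The conditional likelihood `Q_{x₁}(y^T, x^{2:T}; θ,π,G)` of the T-period binary
choice panel model with a predetermined binary covariate, written over full paths
`y x : Fin T → Bool` (conditioning covariate is `x 0`). -/
def QT (T : ℕ) [NeZero T] (F : ℝ → ℝ) (S : Finset ℝ) (p : ParamT T S)
    (y x : Fin T → Bool) : ℝ :=
  ∑ α : ↥S,
    (∏ t : Fin T, bpow (y t) (F (p.1 * bx (x t) + ↑α))) *
    (∏ t : Fin T, if (t : ℕ) = 0 then 1 else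
      bpow (x t) (p.2.2 t (restr y t) (restr x t) α)) *
    p.2.1 (x 0) α

/-- Valid heterogeneity distribution: nonnegative weights summing to one for each `x₁`. -/
def ValidPiT (S : Finset ℝ) (π : Bool → ↥S → ℝ) : Prop :=
  (∀ x1 α, 0 ≤ π x1 α) ∧ ∀ x1, ∑ α : ↥S, π x1 α = 1

/-- Valid feedback process: probabilities in `[0,1]`. -/
def ValidGT (T : ℕ) (S : Finset ℝ) (G : Feedback T S) : Prop :=
  ∀ t yh xh α, G t yh xh α ∈ Set.Icc (0:ℝ) 1

/-- Full covariate path built from the initial covariate `x₁` and `x^{2:T}`. -/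
def consPath {T : ℕ} (x1 : Bool) (xr : Fin (T - 1) → Bool) : Fin T → Bool :=
  fun t => if h : (t : ℕ) = 0 then x1 else xr ⟨(t : ℕ) - 1, by have := t.isLt; omega⟩

/-- Full outcome path built from `y^{T-1}` and the last outcome `y_T`. -/
def snocPath {T : ℕ} (yr : Fin (T - 1) → Bool) (yT : Bool) : Fin T → Bool :=
  fun t => if h : (t : ℕ) < T - 1 then yr ⟨(t : ℕ), h⟩ else yT

/-- Conditions (IS1)–(IS3) of Proposition 1: `ψ_{x₁}(x^{2:T}, y^{T-1}, α)` matches the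
true likelihood, is a valid probability mass function, and is consistent with the
parametric outcome probabilities at the candidate parameter `θ̃`. -/
def PsiFeasible (T : ℕ) [NeZero T] (hT : 2 ≤ T) (S : Finset ℝ) (F : ℝ → ℝ)
    (θ : ℝ) (π : Bool → ↥S → ℝ) (G : Feedback T S) (θt : ℝ)
    (ψ : Bool → (Fin (T - 1) → Bool) → (Fin (T - 1) → Bool) → ↥S → ℝ) : Prop :=
  -- (IS1): ψ reproduces the true likelihood
  (∀ (x1 : Bool) (yr : Fin (T - 1) → Bool) (yT : Bool) (xr : Fin (T - 1) → Bool),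
    QT T F S (θ, π, G) (snocPath yr yT) (consPath x1 xr) =
      ∑ α : ↥S, bpow yT (F (θt * bx (xr ⟨T - 2, by omega⟩) + ↑α)) * ψ x1 xr yr α) ∧
  -- (IS2): ψ is a valid probability mass function
  (∀ x1 xr yr α, 0 ≤ ψ x1 xr yr α) ∧
  (∀ x1 : Bool, ∑ xr : Fin (T - 1) → Bool, ∑ yr : Fin (T - 1) → Bool, ∑ α : ↥S,
    ψ x1 xr yr α = 1) ∧
  -- (IS3): consistency with the outcome probabilities at θ̃ for each s ∈ {2,…,T}
  (∀ (s : ℕ) (hs2 : 2 ≤ s) (hsT : s ≤ T) (α : ↥S) (x1 : Bool)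
      (xr yr : Fin (T - 1) → Bool),
    (∑ xr' ∈ Finset.univ.filter
        (fun xr' : Fin (T - 1) → Bool => ∀ i : Fin (T - 1), (i : ℕ) < s - 2 → xr' i = xr i),
      ∑ yr' ∈ Finset.univ.filter
        (fun yr' : Fin (T - 1) → Bool => ∀ i : Fin (T - 1), (i : ℕ) < s - 1 → yr' i = yr i),
        ψ x1 xr' yr' α) =
    bpow (yr ⟨s - 2, by omega⟩) (F (θt * bx (consPath x1 xr ⟨s - 2, by omega⟩) + ↑α)) *
    (∑ xr' ∈ Finset.univ.filter
        (fun xr' : Fin (T - 1) → Bool => ∀ i : Fin (T - 1), (i : ℕ) < s - 2 → xr' i = xr i),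
      ∑ yr' ∈ Finset.univ.filter
        (fun yr' : Fin (T - 1) → Bool => ∀ i : Fin (T - 1), (i : ℕ) < s - 2 → yr' i = yr i),
        ψ x1 xr' yr' α))

section helpers13

variable {N : ℕ}

/-- paths agreeing with `z` below `k` -/
def agr (k : ℕ) (z : Fin N → Bool) : Finset (Fin N → Bool) :=
  Finset.univ.filter (fun z' : Fin N → Bool => ∀ i : Fin N, (i : ℕ) < k → z' i = z i)

/-- marginal sums -/
def Mg (ψ : (Fin N → Bool) → (Fin N → Bool) → ℝ) (k l : ℕ) (x y : Fin N → Bool) : ℝ :=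
  ∑ x' ∈ agr k x, ∑ y' ∈ agr l y, ψ x' y'

theorem agr_congr (k : ℕ) (z w : Fin N → Bool) (h : ∀ i : Fin N, (i : ℕ) < k → z i = w i) :
    agr k z = agr k w := by
  ext z'
  simp only [agr, Finset.mem_filter, Finset.mem_univ, true_and]
  constructor
  · intro h1 i hi
    rw [h1 i hi, h i hi]
  · intro h1 i hi
    rw [h1 i hi, h i hi]

theorem Mg_congr (ψ : (Fin N → Bool) → (Fin N → Bool) → ℝ) (k l : ℕ) (x y x' y' : Fin N → Bool)
    (hx : ∀ i : Fin N, (i : ℕ) < k → x i = x' i) (hy : ∀ i : Fin N, (i : ℕ) < l → y i = y' i) :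
    Mg ψ k l x y = Mg ψ k l x' y' := by
  unfold Mg
  rw [agr_congr k x x' hx, agr_congr l y y' hy]

theorem agr_zero (z : Fin N → Bool) : agr 0 z = Finset.univ := by
  ext z'; simp [agr]

theorem agr_full (z : Fin N → Bool) : agr N z = {z} := by
  ext z'
  simp only [agr, Finset.mem_filter, Finset.mem_univ, true_and, Finset.mem_singleton]
  exact ⟨fun h => funext fun i => h i i.isLt, fun h i _ => by rw [h]⟩

theorem agr_split (k : Fin N) (z : Fin N → Bool) (f : (Fin N → Bool) → ℝ) :
    ∑ z' ∈ agr (k : ℕ) z, f z' =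
      ∑ z' ∈ agr ((k : ℕ) + 1) (Function.update z k true), f z' +
      ∑ z' ∈ agr ((k : ℕ) + 1) (Function.update z k false), f z' := by
  have key : ∀ b : Bool, agr ((k : ℕ) + 1) (Function.update z k b) =
      (agr (k : ℕ) z).filter (fun z' => z' k = b) := by
    intro b
    ext z'
    simp only [agr, Finset.mem_filter, Finset.mem_univ, true_and]
    constructor
    · intro h
      refine ⟨fun i hi => ?_, ?_⟩
      · have := h i (by omega)
        rwa [Function.update_of_ne (by rintro rfl; omega)] at this
      · simpa using h k (by omega)
    · rintro ⟨h1, h2⟩ i hi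
      by_cases hik : i = k
      · subst hik; simpa using h2
      · rw [Function.update_of_ne hik]
        exact h1 i (by have : (i : ℕ) ≠ k := fun h => hik (Fin.ext h)
                       omega)
  rw [key, key, ← Finset.sum_filter_add_sum_filter_not (agr (k : ℕ) z) (fun z' => z' k = true)]
  simp

theorem Mg_splitx (ψ : (Fin N → Bool) → (Fin N → Bool) → ℝ) (k : Fin N) (l : ℕ)
    (x y : Fin N → Bool) :
    Mg ψ k l x y = Mg ψ ((k : ℕ) + 1) l (Function.update x k true) y +
      Mg ψ ((k : ℕ) + 1) l (Function.update x k false) y := by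
  unfold Mg
  exact agr_split k x _

theorem Mg_splity (ψ : (Fin N → Bool) → (Fin N → Bool) → ℝ) (k : Fin N) (l : ℕ)
    (x y : Fin N → Bool) :
    Mg ψ l k x y = Mg ψ l ((k : ℕ) + 1) x (Function.update y k true) +
      Mg ψ l ((k : ℕ) + 1) x (Function.update y k false) := by
  unfold Mg
  rw [← Finset.sum_add_distrib]
  exact Finset.sum_congr rfl fun x' _ => agr_split k y _

theorem Mg_full (ψ : (Fin N → Bool) → (Fin N → Bool) → ℝ) (x y : Fin N → Bool) :
    Mg ψ N N x y = ψ x y := by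
  unfold Mg
  rw [agr_full, agr_full]; simp

theorem Mg_nonneg (ψ : (Fin N → Bool) → (Fin N → Bool) → ℝ) (h : ∀ x y, 0 ≤ ψ x y) (k l : ℕ)
    (x y : Fin N → Bool) : 0 ≤ Mg ψ k l x y :=
  Finset.sum_nonneg fun _ _ => Finset.sum_nonneg fun _ _ => h _ _

/-- partial products -/
def Hp (b g : Fin N → (Fin N → Bool) → (Fin N → Bool) → ℝ) (k : ℕ) (x y : Fin N → Bool) : ℝ :=
  ∏ j ∈ Finset.univ.filter (fun j : Fin N => (j : ℕ) < k), (b j x y * g j x y)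

theorem Hp_zero (b g : Fin N → (Fin N → Bool) → (Fin N → Bool) → ℝ) (x y : Fin N → Bool) :
    Hp b g 0 x y = 1 := by simp [Hp]

theorem Hp_full (b g : Fin N → (Fin N → Bool) → (Fin N → Bool) → ℝ) (x y : Fin N → Bool) :
    Hp b g N x y = ∏ j, (b j x y * g j x y) := by simp [Hp]

theorem Hp_succ (b g : Fin N → (Fin N → Bool) → (Fin N → Bool) → ℝ) (k : Fin N)
    (x y : Fin N → Bool) :
    Hp b g ((k : ℕ) + 1) x y = Hp b g k x y * (b k x y * g k x y) := by
  unfold Hp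
  have : Finset.univ.filter (fun j : Fin N => (j : ℕ) < (k : ℕ) + 1) =
      insert k (Finset.univ.filter (fun j : Fin N => (j : ℕ) < (k : ℕ))) := by
    ext j
    simp only [Finset.mem_filter, Finset.mem_univ, true_and, Finset.mem_insert, Fin.ext_iff]
    omega
  rw [this, Finset.prod_insert (by simp)]
  ring

theorem Hp_congr (b g : Fin N → (Fin N → Bool) → (Fin N → Bool) → ℝ) (k : ℕ)
    (x y x' y' : Fin N → Bool)
    (hb : ∀ j : Fin N, (j : ℕ) < k → b j x y = b j x' y')
    (hg : ∀ j : Fin N, (j : ℕ) < k → g j x y = g j x' y') :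
    Hp b g k x y = Hp b g k x' y' := by
  unfold Hp
  refine Finset.prod_congr rfl fun j hj => ?_
  have hj' : (j : ℕ) < k := by simpa using hj
  rw [hb j hj', hg j hj']

theorem forward_core (b g : Fin N → (Fin N → Bool) → (Fin N → Bool) → ℝ) (c : ℝ)
    (hb : ∀ (j : Fin N) (x y x' y' : Fin N → Bool), (∀ i : Fin N, (i : ℕ) < j → x i = x' i) →
      (∀ i : Fin N, (i : ℕ) < (j : ℕ) + 1 → y i = y' i) → b j x y = b j x' y')
    (hg : ∀ (j : Fin N) (x y x' y' : Fin N → Bool),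
      (∀ i : Fin N, (i : ℕ) < (j : ℕ) + 1 → x i = x' i) →
      (∀ i : Fin N, (i : ℕ) < (j : ℕ) + 1 → y i = y' i) → g j x y = g j x' y')
    (hb1 : ∀ (j : Fin N) (x y : Fin N → Bool),
      b j x (Function.update y j true) + b j x (Function.update y j false) = 1)
    (hg1 : ∀ (j : Fin N) (x y : Fin N → Bool),
      g j (Function.update x j true) y + g j (Function.update x j false) y = 1) :
    (∀ k : ℕ, k ≤ N → ∀ x y, Mg (fun x y => Hp b g N x y * c) k k x y = Hp b g k x y * c) ∧
    (∀ k : Fin N, ∀ x y, Mg (fun x y => Hp b g N x y * c) k ((k : ℕ) + 1) x y =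
      b k x y * (Hp b g k x y * c)) := by
  set ψ : (Fin N → Bool) → (Fin N → Bool) → ℝ := fun x y => Hp b g N x y * c with hψ
  have Hupx : ∀ (k : Fin N) (v : Bool) x y, Hp b g k (Function.update x k v) y = Hp b g k x y := by
    intro k v x y
    have hne : ∀ i : Fin N, (i : ℕ) < k → Function.update x k v i = x i := fun i hi =>
      Function.update_of_ne (by rintro rfl; omega) _ _
    exact Hp_congr _ _ _ _ _ _ _
      (fun j hj => hb j _ _ _ _ (fun i hi => hne i (by omega)) (fun _ _ => rfl))
      (fun j hj => hg j _ _ _ _ (fun i hi => hne i (by omega)) (fun _ _ => rfl))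
  have Hupy : ∀ (k : Fin N) (v : Bool) x y, Hp b g k x (Function.update y k v) = Hp b g k x y := by
    intro k v x y
    have hne : ∀ i : Fin N, (i : ℕ) < k → Function.update y k v i = y i := fun i hi =>
      Function.update_of_ne (by rintro rfl; omega) _ _
    exact Hp_congr _ _ _ _ _ _ _
      (fun j hj => hb j _ _ _ _ (fun _ _ => rfl) (fun i hi => hne i (by omega)))
      (fun j hj => hg j _ _ _ _ (fun _ _ => rfl) (fun i hi => hne i (by omega)))
  have bupx : ∀ (k : Fin N) (v : Bool) x y, b k (Function.update x k v) y = b k x y := by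
    intro k v x y
    exact hb k _ _ _ _ (fun i hi => Function.update_of_ne (by rintro rfl; omega) _ _)
      (fun _ _ => rfl)
  have step1 : ∀ k : Fin N,
      (∀ x y, Mg ψ ((k : ℕ) + 1) ((k : ℕ) + 1) x y = Hp b g ((k : ℕ) + 1) x y * c) →
      ∀ x y, Mg ψ k ((k : ℕ) + 1) x y = b k x y * (Hp b g k x y * c) := by
    intro k ih x y
    rw [Mg_splitx, ih, ih, Hp_succ, Hp_succ, Hupx, Hupx, bupx, bupx]
    linear_combination (Hp b g k x y * b k x y * c) * hg1 k x y
  have step2 : ∀ k : Fin N,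
      (∀ x y, Mg ψ ((k : ℕ) + 1) ((k : ℕ) + 1) x y = Hp b g ((k : ℕ) + 1) x y * c) →
      ∀ x y, Mg ψ k k x y = Hp b g k x y * c := by
    intro k ih x y
    rw [Mg_splity, step1 k ih, step1 k ih, Hupy, Hupy]
    linear_combination (Hp b g k x y * c) * hb1 k x y
  have main : ∀ k : ℕ, k ≤ N → ∀ x y, Mg ψ k k x y = Hp b g k x y * c := by
    intro k hk
    induction hk using Nat.decreasingInduction with
    | self => intro x y; rw [Mg_full]
    | of_succ k hk ih => exact step2 ⟨k, hk⟩ ih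
  exact ⟨main, fun k => step1 k (main _ k.isLt)⟩

theorem backward_core (ψ : (Fin N → Bool) → (Fin N → Bool) → ℝ)
    (b g : Fin N → (Fin N → Bool) → (Fin N → Bool) → ℝ) (x y : Fin N → Bool)
    (hb : ∀ k : Fin N, Mg ψ k ((k : ℕ) + 1) x y = b k x y * Mg ψ k k x y)
    (hg : ∀ k : Fin N, Mg ψ ((k : ℕ) + 1) ((k : ℕ) + 1) x y =
      g k x y * Mg ψ k ((k : ℕ) + 1) x y) :
    ψ x y = (∏ j, (b j x y * g j x y)) * ∑ x', ∑ y', ψ x' y' := by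
  have main : ∀ k : ℕ, k ≤ N → Mg ψ k k x y = Hp b g k x y * Mg ψ 0 0 x y := by
    intro k
    induction k with
    | zero => intro _; rw [Hp_zero, one_mul]
    | succ k ih =>
      intro hk
      have h1 := hg ⟨k, hk⟩
      have h2 := hb ⟨k, hk⟩
      have h3 := Hp_succ b g ⟨k, hk⟩ x y
      have h4 := ih (by omega)
      simp only at h1 h2 h3
      rw [h1, h2, h3, h4]; ring
  have := main N le_rfl
  rw [Mg_full, Hp_full] at this
  rw [this]
  simp [Mg, agr_zero]

theorem bpow_nonneg (v : Bool) (p : ℝ) (h : p ∈ Set.Icc (0:ℝ) 1) : 0 ≤ bpow v p := by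
  have := h.1
  have := h.2
  cases v <;> simp [bpow] <;> linarith

/-- outcome factor -/
def bF (F : ℝ → ℝ) (θ α : ℝ) (x1 : Bool) (j : Fin N) (xr yr : Fin N → Bool) : ℝ :=
  bpow (yr j) (F (θ * bx (consPath (T := N + 1) x1 xr j.castSucc) + α))

/-- feedback factor -/
def gF {S : Finset ℝ} (G : Feedback (N + 1) S) (α : ↥S) (x1 : Bool) (j : Fin N)
    (xr yr : Fin N → Bool) : ℝ :=
  bpow (xr j) (G j.succ (restr (snocPath (T := N + 1) yr false) j.succ)
    (restr (consPath (T := N + 1) x1 xr) j.succ) α)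

theorem consPath_succ (x1 : Bool) (xr : Fin N → Bool) (j : Fin N) :
    consPath (T := N + 1) x1 xr j.succ = xr j := by
  simp [consPath]

theorem snocPath_castSucc (yr : Fin N → Bool) (yT : Bool) (j : Fin N) :
    snocPath (T := N + 1) yr yT j.castSucc = yr j := by
  simp [snocPath]

theorem snocPath_last (yr : Fin N → Bool) (yT : Bool) :
    snocPath (T := N + 1) yr yT (Fin.last N) = yT := by
  simp [snocPath]

theorem restr_snoc (yr : Fin N → Bool) (yT : Bool) (j : Fin N) :
    restr (snocPath (T := N + 1) yr yT) j.succ = restr (snocPath (T := N + 1) yr false) j.succ := by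
  funext i
  have h1 := i.isLt
  have h2 := j.isLt
  have h3 : (j.succ : ℕ) = j + 1 := Fin.val_succ j
  have : (i : ℕ) < N := by omega
  simp [restr, snocPath, this]

theorem QT_form [NeZero (N + 1)] (hN : 1 ≤ N) (F : ℝ → ℝ) (S : Finset ℝ) (θ : ℝ)
    (π : Bool → ↥S → ℝ) (G : Feedback (N + 1) S) (x1 yT : Bool) (xr yr : Fin N → Bool) :
    QT (N + 1) F S (θ, π, G) (snocPath (T := N + 1) yr yT) (consPath (T := N + 1) x1 xr) =
      ∑ α : ↥S, bpow yT (F (θ * bx (xr ⟨N - 1, by omega⟩) + ↑α)) *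
        ((∏ j, (bF F θ α x1 j xr yr * gF G α x1 j xr yr)) * π x1 α) := by
  unfold QT
  refine Finset.sum_congr rfl fun α _ => ?_
  have hlast : consPath (T := N + 1) x1 xr (Fin.last N) = xr ⟨N - 1, by omega⟩ := by
    have : N ≠ 0 := by omega
    simp [consPath, this]
  have h0 : consPath (T := N + 1) x1 xr 0 = x1 := by
    simp [consPath]
  rw [h0, Fin.prod_univ_castSucc, Fin.prod_univ_succ, Finset.prod_mul_distrib]
  simp only [snocPath_castSucc, snocPath_last, hlast, consPath_succ, restr_snoc yr yT]
  simp only [bF, gF, Fin.val_succ, Nat.succ_ne_zero, if_false, Fin.val_zero, if_true]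
  ring

theorem path_y (y : Fin (N + 1) → Bool) :
    y = snocPath (T := N + 1) (fun i : Fin N => y i.castSucc) (y (Fin.last N)) := by
  funext t
  refine Fin.lastCases ?_ (fun j => ?_) t
  · rw [snocPath_last]
  · rw [snocPath_castSucc]

theorem path_x (x : Fin (N + 1) → Bool) :
    x = consPath (T := N + 1) (x 0) (fun i : Fin N => x i.succ) := by
  funext t
  refine Fin.cases ?_ (fun j => ?_) t
  · simp [consPath]
  · rw [consPath_succ]

/-- truncated path -/
def extP {t : ℕ} (d : ℕ) (h : Fin t → Bool) : Fin N → Bool :=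
  fun i => if hi : (i : ℕ) + d < t then h ⟨i + d, hi⟩ else false

/-- feedback built from ψ -/
def GofPsi {S : Finset ℝ} (ψ : Bool → (Fin N → Bool) → (Fin N → Bool) → ↥S → ℝ) :
    Feedback (N + 1) S := fun t yh xh α =>
  if h : (t : ℕ) = 0 then 0 else
    Mg (fun x y => ψ (xh ⟨0, by omega⟩) x y α) t t
      (Function.update (extP 1 xh) ⟨t - 1, by have := t.isLt; omega⟩ true) (extP 0 yh) /
    Mg (fun x y => ψ (xh ⟨0, by omega⟩) x y α) (t - 1) t (extP 1 xh) (extP 0 yh)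

theorem Mg_le (ψ : (Fin N → Bool) → (Fin N → Bool) → ℝ) (h : ∀ x y, 0 ≤ ψ x y) (k : Fin N) (l : ℕ)
    (x y : Fin N → Bool) (v : Bool) :
    Mg ψ ((k : ℕ) + 1) l (Function.update x k v) y ≤ Mg ψ k l x y := by
  rw [Mg_splitx]
  have h1 := Mg_nonneg ψ h ((k : ℕ) + 1) l (Function.update x k true) y
  have h2 := Mg_nonneg ψ h ((k : ℕ) + 1) l (Function.update x k false) y
  cases v <;> linarith

theorem GofPsi_valid {S : Finset ℝ} (ψ : Bool → (Fin N → Bool) → (Fin N → Bool) → ↥S → ℝ)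
    (h : ∀ x1 x y α, 0 ≤ ψ x1 x y α) : ValidGT (N + 1) S (GofPsi ψ) := by
  intro t yh xh α
  unfold GofPsi
  split_ifs with ht
  · simp
  · have hn := Mg_nonneg (fun x y => ψ (xh ⟨0, by omega⟩) x y α) (fun x y => h _ x y α)
    have hle := Mg_le (fun x y => ψ (xh ⟨0, by omega⟩) x y α) (fun x y => h _ x y α)
      ⟨t - 1, by have := t.isLt; omega⟩ t (extP 1 xh) (extP 0 yh) true
    have e : (t : ℕ) - 1 + 1 = t := by omega
    simp only [e] at hle
    exact ⟨div_nonneg (hn _ _ _ _) (hn _ _ _ _), div_le_one_of_le₀ hle (hn _ _ _ _)⟩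

theorem GofPsi_step {S : Finset ℝ} (ψ : Bool → (Fin N → Bool) → (Fin N → Bool) → ↥S → ℝ)
    (h : ∀ x1 x y α, 0 ≤ ψ x1 x y α) (x1 : Bool) (α : ↥S) (k : Fin N) (xr yr : Fin N → Bool) :
    Mg (fun x y => ψ x1 x y α) ((k : ℕ) + 1) ((k : ℕ) + 1) xr yr =
      gF (GofPsi ψ) α x1 k xr yr * Mg (fun x y => ψ x1 x y α) k ((k : ℕ) + 1) xr yr := by
  set f := (fun x y => ψ x1 x y α) with hf
  have hfn : ∀ x y, 0 ≤ f x y := fun x y => h _ _ _ _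
  have hG : GofPsi ψ k.succ (restr (snocPath (T := N + 1) yr false) k.succ)
      (restr (consPath (T := N + 1) x1 xr) k.succ) α =
      Mg f ((k : ℕ) + 1) ((k : ℕ) + 1) (Function.update xr k true) yr /
        Mg f k ((k : ℕ) + 1) xr yr := by
    have hx : ∀ i : Fin N, (i : ℕ) < k →
        extP (N := N) 1 (restr (consPath (T := N + 1) x1 xr) k.succ) i = xr i := by
      intro i hi
      simp [extP, restr, consPath, hi]
    have hy : ∀ i : Fin N, (i : ℕ) < (k : ℕ) + 1 →
        extP (N := N) 0 (restr (snocPath (T := N + 1) yr false) k.succ) i = yr i := by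
      intro i hi
      simp [extP, restr, snocPath, hi]
    have h0 : restr (consPath (T := N + 1) x1 xr) k.succ ⟨0, by simp⟩ = x1 := by
      simp [restr, consPath]
    unfold GofPsi
    rw [dif_neg (by simp)]
    rw [h0]
    congr 1
    · refine Mg_congr _ _ _ _ _ _ _ ?_ hy
      intro i hi
      by_cases hik : i = k
      · subst hik; simp
      · have hne : (i : ℕ) ≠ k := fun h => hik (Fin.ext h)
        have hi' : (i : ℕ) < k + 1 := hi
        rw [Function.update_of_ne hik, Function.update_of_ne (by simpa [Fin.ext_iff] using hne)]
        exact hx i (by omega)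
    · exact Mg_congr _ _ _ _ _ _ _ hx hy
  have hs := Mg_splitx f k ((k : ℕ) + 1) xr yr
  have ht := Mg_nonneg f hfn ((k : ℕ) + 1) ((k : ℕ) + 1) (Function.update xr k true) yr
  have hff := Mg_nonneg f hfn ((k : ℕ) + 1) ((k : ℕ) + 1) (Function.update xr k false) yr
  have hself : Function.update xr k (xr k) = xr := Function.update_eq_self k xr
  unfold gF
  rw [hG]
  by_cases hz : Mg f k ((k : ℕ) + 1) xr yr = 0
  · rw [hz, mul_zero]
    rw [← hself]
    cases xr k <;> linarith
  · have hM : Mg f ((k : ℕ) + 1) ((k : ℕ) + 1) xr yr =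
        Mg f ((k : ℕ) + 1) ((k : ℕ) + 1) (Function.update xr k (xr k)) yr := by rw [hself]
    rw [hM]
    cases xr k
    · simp only [bpow, Bool.false_eq_true, if_false]
      field_simp
      linarith
    · simp only [bpow, if_true]
      field_simp

end helpers13

/-- **Proposition 1 (linear programming characterization of the identified set)**:
`θ̃ ∈ Θᴵ` if and only if there exist functions `ψ_{x₁}(x^{2:T}, y^{T-1}, α)` satisfying
conditions (IS1)–(IS3). -/
theorem statement_13 (T : ℕ) [NeZero T] (hT : 2 ≤ T)
    (S : Finset ℝ) (F : ℝ → ℝ) (hF : ∀ u, F u ∈ Set.Icc (0:ℝ) 1)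
    (θ : ℝ) (π : Bool → ↥S → ℝ) (G : Feedback T S)
    (hπ : ValidPiT S π) (hG : ValidGT T S G)
    (θt : ℝ) :
    (∃ πt Gt, ValidPiT S πt ∧ ValidGT T S Gt ∧
      QT T F S (θt, πt, Gt) = QT T F S (θ, π, G)) ↔
    (∃ ψ : Bool → (Fin (T - 1) → Bool) → (Fin (T - 1) → Bool) → ↥S → ℝ,
      PsiFeasible T hT S F θ π G θt ψ) := by
  obtain ⟨N, rfl⟩ : ∃ N, T = N + 1 := ⟨T - 1, by omega⟩
  have hN : 1 ≤ N := by omega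
  constructor
  · rintro ⟨πt, Gt, hπt, hGt, hQ⟩
    have core := fun (x1 : Bool) (α : ↥S) =>
      forward_core (N := N) (bF F θt α x1) (gF Gt α x1) (πt x1 α)
        (by
          intro j x y x' y' hx hy
          have hc : consPath (T := N + 1) x1 x j.castSucc =
              consPath (T := N + 1) x1 x' j.castSucc := by
            by_cases h0 : (j : ℕ) = 0
            · simp [consPath, h0]
            · simp only [consPath, Fin.val_castSucc, h0, dite_false]
              exact hx _ (by simp only []; omega)
          unfold bF
          rw [hc, hy j (by omega)])
        (by
          intro j x y x' y' hx hy
          have h1 : restr (consPath (T := N + 1) x1 x) j.succ =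
              restr (consPath (T := N + 1) x1 x') j.succ := by
            funext i
            have hi : (i : ℕ) < j + 1 := i.isLt
            by_cases h0 : (i : ℕ) = 0
            · simp [restr, consPath, h0]
            · simp only [restr, consPath, h0, dite_false]
              exact hx _ (by simp only []; omega)
          have h2 : restr (snocPath (T := N + 1) y false) j.succ =
              restr (snocPath (T := N + 1) y' false) j.succ := by
            funext i
            have hi : (i : ℕ) < j + 1 := i.isLt
            have hj := j.isLt
            have hiN : (i : ℕ) < N + 1 - 1 := by omega
            simp only [restr, snocPath, hiN, dite_true]
            exact hy _ hi
          unfold gF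
          rw [h1, h2, hx j (by omega)])
        (by intro j x y; simp [bF, bpow])
        (by
          intro j x y
          have h1 : ∀ v, restr (consPath (T := N + 1) x1 (Function.update x j v)) j.succ =
              restr (consPath (T := N + 1) x1 x) j.succ := by
            intro v
            funext i
            have hi : (i : ℕ) < j + 1 := i.isLt
            by_cases h0 : (i : ℕ) = 0
            · simp [restr, consPath, h0]
            · simp only [restr, consPath, h0, dite_false]
              refine Function.update_of_ne ?_ _ _
              intro h
              have := congrArg Fin.val h
              simp only [] at this
              omega
          unfold gF
          rw [h1, h1]
          simp [bpow])
    refine ⟨fun x1 xr yr α => Hp (N := N) (bF F θt α x1) (gF Gt α x1) N xr yr * πt x1 α,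
      ?_, ?_, ?_, ?_⟩
    · intro x1 yr yT xr
      rw [← hQ]
      refine (QT_form hN F S θt πt Gt x1 yT xr yr).trans ?_
      refine Finset.sum_congr rfl fun α _ => ?_
      rw [← Hp_full]
      rfl
    · intro x1 xr yr α
      refine mul_nonneg (Finset.prod_nonneg fun j _ => mul_nonneg ?_ ?_) (hπt.1 _ _)
      · exact bpow_nonneg _ _ (hF _)
      · exact bpow_nonneg _ _ (hGt _ _ _ _)
    · intro x1
      rw [← hπt.2 x1]
      have e : ∀ α : ↥S, πt x1 α = ∑ xr : Fin N → Bool, ∑ yr : Fin N → Bool,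
          Hp (bF F θt α x1) (gF Gt α x1) N xr yr * πt x1 α := by
        intro α
        have := (core x1 α).1 0 (by omega) (fun _ => false) (fun _ => false)
        rw [Hp_zero, one_mul] at this
        simpa [Mg, agr_zero] using this.symm
      refine Eq.trans ?_ (Finset.sum_congr rfl (fun α _ => e α)).symm
      refine Eq.trans ?_ Finset.sum_comm
      exact Finset.sum_congr rfl fun xr _ => Finset.sum_comm
    · intro s hs2 hsT α x1 xr yr
      obtain ⟨k, rfl⟩ : ∃ k, s = k + 2 := ⟨s - 2, by omega⟩
      have hk : k < N := by omega
      have h1 := (core x1 α).2 ⟨k, hk⟩ xr yr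
      rw [← (core x1 α).1 k hk.le xr yr] at h1
      exact h1
  · rintro ⟨ψ, h1, h2, h3, h4⟩
    change Bool → (Fin N → Bool) → (Fin N → Bool) → ↥S → ℝ at ψ
    refine ⟨fun x1 α => ∑ xr : Fin N → Bool, ∑ yr : Fin N → Bool, ψ x1 xr yr α, GofPsi ψ, ⟨?_, ?_⟩, GofPsi_valid ψ h2, ?_⟩
    · intro x1 α
      exact Finset.sum_nonneg fun _ _ => Finset.sum_nonneg fun _ _ => h2 _ _ _ _
    · intro x1
      refine Eq.trans ?_ (h3 x1)
      refine Finset.sum_comm.trans ?_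
      exact Finset.sum_congr rfl fun xr _ => Finset.sum_comm
    · funext y x
      rw [path_y y, path_x x]
      refine (QT_form hN F S θt _ _ _ _ _ _).trans ?_
      refine Eq.trans ?_ (h1 _ _ _ _).symm
      refine Finset.sum_congr rfl fun α _ => ?_
      have := backward_core (fun xr yr => ψ (x 0) xr yr α) (bF F θt α (x 0))
        (gF (GofPsi ψ) α (x 0)) (fun i : Fin N => x i.succ) (fun i : Fin N => y i.castSucc)
        (fun k => h4 (k + 2) (by omega) (by omega) α (x 0) _ _)
        (fun k => GofPsi_step ψ h2 (x 0) α k _ _)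
      rw [← this]
      rfl
end
end

section
/- Let T=2, S⊂ℝ finite, F:ℝ→[0,1], and let (θ,π,G) be true parameters of the two-period binary choice panel model with a binary predetermined covariate, with conditional likelihood Q_{x_1}(y_2,y_1,x_2;θ,π,G)=Σ_{α∈S} F(θx_2+α)^{y_2}(1−F(θx_2+α))^{1−y_2}·G^2_{y_1,x_1}(α)^{x_2}(1−G^2_{y_1,x_1}(α))^{1−x_2}·F(θx_1+α)^{y_1}(1−F(θx_1+α))^{1−y_1}·π_{x_1}(α). Then θ̃∈Θ^I if and only if there exist functions ψ_{x_1}:{0,1}×{0,1}×S→ℝ (arguments (x_2,y_1,α)), x_1∈{0,1}, such that: (a) ψ_{x_1}(x_2,y_1,α)≥0 and Σ_{x_2=0}^1 Σ_{y_1=0}^1 Σ_{α∈S} ψ_{x_1}(x_2,y_1,α)=1; (b) for all y_1∈{0,1} and α∈S: Σ_{x_2=0}^1 ψ_{x_1}(x_2,y_1,α) = F(θ̃x_1+α)^{y_1}(1−F(θ̃x_1+α))^{1−y_1} · Σ_{x_2=0}^1 Σ_{y_1'=0}^1 ψ_{x_1}(x_2,y_1',α); and (c) for all (y_2,y_1,x_2):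 Q_{x_1}(y_2,y_1,x_2;θ,π,G) = Σ_{α∈S} F(θ̃x_2+α)^{y_2}(1−F(θ̃x_2+α))^{1−y_2}·ψ_{x_1}(x_2,y_1,α). -/
open Finset

noncomputable section

/-- Parameter space of the two-period model. -/
abbrev Param2 (S : Finset ℝ) : Type :=
  ℝ × (Bool → ↥S → ℝ) × (Bool → Bool → ↥S → ℝ)

/-- The conditional likelihood of the two-period binary choice panel model with a
predetermined binary covariate; arguments ordered `x₁ y₁ y₂ x₂`. -/
def Q2 (F : ℝ → ℝ) (S : Finset ℝ) (p : Param2 S) :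
    Bool → Bool → Bool → Bool → ℝ :=
  fun x1 y1 y2 x2 => ∑ α : ↥S, bpow y2 (F (p.1 * bx x2 + ↑α)) *
    bpow x2 (p.2.2 y1 x1 α) * bpow y1 (F (p.1 * bx x1 + ↑α)) * p.2.1 x1 α

/-- Valid heterogeneity distribution: nonnegative weights summing to one for each `x₁`. -/
def ValidPi2 (S : Finset ℝ) (π : Bool → ↥S → ℝ) : Prop :=
  (∀ x1 α, 0 ≤ π x1 α) ∧ ∀ x1, ∑ α : ↥S, π x1 α = 1

/-- Valid feedback process: probabilities in `[0,1]`. -/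
def ValidG2 (S : Finset ℝ) (G : Bool → Bool → ↥S → ℝ) : Prop :=
  ∀ y1 x1 α, G y1 x1 α ∈ Set.Icc (0:ℝ) 1

/-- **Linear-programming characterization of the identified set with T = 2 (equations
(12)–(14) of the paper)**: `θ̃ ∈ Θᴵ` iff there exist functions `ψ_{x₁}(x₂,y₁,α)`
that form a valid probability mass function (a), are consistent with the period-1
outcome probabilities at `θ̃` (b), and reproduce the true likelihood (c). -/
theorem statement_14 (S : Finset ℝ) (F : ℝ → ℝ) (hF : ∀ u, F u ∈ Set.Icc (0:ℝ) 1)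
    (θ : ℝ) (π : Bool → ↥S → ℝ) (G : Bool → Bool → ↥S → ℝ)
    (hπ : ValidPi2 S π) (hG : ValidG2 S G)
    (θt : ℝ) :
    (∃ πt Gt, ValidPi2 S πt ∧ ValidG2 S Gt ∧
      Q2 F S (θt, πt, Gt) = Q2 F S (θ, π, G)) ↔
    (∃ ψ : Bool → Bool → Bool → ↥S → ℝ,  -- ψ x₁ x₂ y₁ α
      -- (a) valid probability mass function
      (∀ x1 x2 y1 α, 0 ≤ ψ x1 x2 y1 α) ∧
      (∀ x1 : Bool, ∑ x2 : Bool, ∑ y1 : Bool, ∑ α : ↥S, ψ x1 x2 y1 α = 1) ∧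
      -- (b) consistency with the period-1 outcome probabilities at θ̃
      (∀ (x1 y1 : Bool) (α : ↥S),
        (∑ x2 : Bool, ψ x1 x2 y1 α) =
          bpow y1 (F (θt * bx x1 + ↑α)) * ∑ x2 : Bool, ∑ y1' : Bool, ψ x1 x2 y1' α) ∧
      -- (c) reproduces the true likelihood
      (∀ x1 y1 y2 x2 : Bool,
        Q2 F S (θ, π, G) x1 y1 y2 x2 =
          ∑ α : ↥S, bpow y2 (F (θt * bx x2 + ↑α)) * ψ x1 x2 y1 α)) := by
  have bn : ∀ (b : Bool) (p : ℝ), p ∈ Set.Icc (0:ℝ) 1 → 0 ≤ bpow b p := by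
    rintro (_|_) p ⟨h0, h1⟩ <;> simp [bpow] <;> linarith
  constructor
  · rintro ⟨πt, Gt, hp, hg, hQ⟩
    refine ⟨fun x1 x2 y1 α => bpow x2 (Gt y1 x1 α) * bpow y1 (F (θt * bx x1 + ↑α)) * πt x1 α,
      ?_, ?_, ?_, ?_⟩
    · intro x1 x2 y1 α
      exact mul_nonneg (mul_nonneg (bn _ _ (hg _ _ _)) (bn _ _ (hF _))) (hp.1 _ _)
    · intro x1
      rw [← hp.2 x1]
      simp only [Fintype.sum_bool, ← Finset.sum_add_distrib]
      refine Finset.sum_congr rfl fun α _ => ?_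
      simp [bpow]
      ring
    · intro x1 y1 α
      cases y1 <;> simp [bpow] <;> ring
    · intro x1 y1 y2 x2
      rw [← hQ]
      simp only [Q2]
      refine Finset.sum_congr rfl fun α _ => ?_
      ring
  · rintro ⟨ψ, h0, h1, hb, hc⟩
    refine ⟨fun x1 α => ∑ x2 : Bool, ∑ y1 : Bool, ψ x1 x2 y1 α,
      fun y1 x1 α => ψ x1 true y1 α / ∑ x2 : Bool, ψ x1 x2 y1 α, ⟨?_, ?_⟩, ?_, ?_⟩
    · intro x1 α
      exact Finset.sum_nonneg fun _ _ => Finset.sum_nonneg fun _ _ => h0 _ _ _ _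
    · intro x1
      rw [← h1 x1]
      simp only [Fintype.sum_bool, ← Finset.sum_add_distrib]
    · intro y1 x1 α
      have ht := h0 x1 true y1 α
      have hf := h0 x1 false y1 α
      simp only [Fintype.sum_bool]
      exact ⟨div_nonneg ht (add_nonneg ht hf),
        div_le_one_of_le₀ (by linarith) (add_nonneg ht hf)⟩
    · funext x1 y1 y2 x2
      rw [hc]
      simp only [Q2]
      refine Finset.sum_congr rfl fun α _ => ?_
      rw [mul_assoc, ← hb, mul_assoc]
      congr 1
      have ht := h0 x1 true y1 α
      have hf := h0 x1 false y1 α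
      simp only [Fintype.sum_bool]
      by_cases hz : ψ x1 true y1 α + ψ x1 false y1 α = 0
      · rw [hz, mul_zero]
        cases x2 <;> linarith
      · cases x2 <;> simp [bpow] <;> field_simp
        ring
end
end
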